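/- Let β : [a, b] → (0,∞) be non-decreasing with 0 ≤ a < b, let c > 0 be a real constant and k ≥ 1 an integer, and suppose that for almost every r ∈ (a, b) (with respect to Lebesgue measure) β is differentiable at r with β'(r) ≥ c·β(r)^{(k-1)/k}. Then β(b)^{1/k} ≥ β(a)^{1/k} + (c/k)·(b − a). -/

import Mathlib

open MeasureTheory Set

/-- A monotone function on `[a, b]` whose derivative is a.e. at least `m` grows by at least
`m * (b - a)`. -/
theorem MonotoneOn.mul_sub_le_sub_of_ae_le_deriv {f : ℝ → ℝ} {a b m : ℝ} (hab : a ≤ b)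
    (hf : MonotoneOn f (Icc a b)) (hm : ∀ᵐ r ∂(volume.restrict (Ioo a b)), m ≤ deriv f r) :
    m * (b - a) ≤ f b - f a := by
  have hf' : MonotoneOn f (uIcc a b) := by rwa [uIcc_of_le hab]
  have hint : ∫ _ in a..b, m ≤ ∫ r in a..b, deriv f r := by
    refine intervalIntegral.integral_mono_ae_restrict hab intervalIntegrable_const
      hf'.intervalIntegrable_deriv ?_
    rwa [Filter.EventuallyLE, ← restrict_Ioo_eq_restrict_Icc]
  have hmem := hf'.intervalIntegral_deriv_mem_uIcc
  rw [uIcc_of_le (sub_nonneg.2 (hf (left_mem_Icc.2 hab) (right_mem_Icc.2 hab) hab))] at hmem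
  rw [intervalIntegral.integral_const, smul_eq_mul, mul_comm] at hint
  exact hint.trans hmem.2

/-- Integration step of the growth lemma: if `β : [a,b] → (0,∞)` is non-decreasing and
for a.e. `r ∈ (a,b)` it is differentiable at `r` with `β' r ≥ c · (β r)^((k-1)/k)`,
then `β(b)^(1/k) ≥ β(a)^(1/k) + (c/k)(b - a)`. -/
theorem growth_integration_step (a b : ℝ) (ha : 0 ≤ a) (hab : a < b)
    (β : ℝ → ℝ) (c : ℝ) (hc : 0 < c) (k : ℕ) (hk : 1 ≤ k)
    (hmono : MonotoneOn β (Icc a b))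
    (hpos : ∀ r ∈ Icc a b, 0 < β r)
    (hdiff : ∀ᵐ r ∂(volume.restrict (Ioo a b)),
      DifferentiableAt ℝ β r ∧
        c * (β r) ^ (((k : ℝ) - 1) / (k : ℝ)) ≤ deriv β r) :
    β a ^ ((1 : ℝ) / (k : ℝ)) + (c / (k : ℝ)) * (b - a) ≤ β b ^ ((1 : ℝ) / (k : ℝ)) := by
  have hk0 : (0 : ℝ) < k := by exact_mod_cast hk
  have hroot : MonotoneOn (fun r => β r ^ ((1 : ℝ) / (k : ℝ))) (Icc a b) := fun x hx y hy hxy =>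
    Real.rpow_le_rpow (hpos x hx).le (hmono hx hy hxy) (by positivity)
  have hderiv : ∀ᵐ r ∂(volume.restrict (Ioo a b)),
      c / (k : ℝ) ≤ deriv (fun r => β r ^ ((1 : ℝ) / (k : ℝ))) r := by
    filter_upwards [hdiff, ae_restrict_mem measurableSet_Ioo] with r ⟨hd, hle⟩ hr
    have hβ : 0 < β r := hpos r (Ioo_subset_Icc_self hr)
    rw [(hd.hasDerivAt.rpow_const (Or.inl hβ.ne')).deriv]
    have hcancel : β r ^ (((k : ℝ) - 1) / k) * β r ^ ((1 : ℝ) / k - 1) = 1 := by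
      rw [← Real.rpow_add hβ]
      have : ((k : ℝ) - 1) / k + (1 / k - 1) = 0 := by field_simp; ring
      rw [this, Real.rpow_zero]
    calc c / (k : ℝ)
        = c * (β r ^ (((k : ℝ) - 1) / k) * β r ^ ((1 : ℝ) / k - 1)) * (1 / k) := by
          rw [hcancel]; ring
      _ = c * β r ^ (((k : ℝ) - 1) / k) * (1 / k) * β r ^ ((1 : ℝ) / k - 1) := by ring
      _ ≤ deriv β r * (1 / k) * β r ^ ((1 : ℝ) / k - 1) := by gcongr
  linarith [hroot.mul_sub_le_sub_of_ae_le_deriv hab.le hderiv]
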